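/- Let Γ ⊂ P^n be a nondegenerate finite subscheme of degree d over an algebraically closed field of characteristic 0 such that ⌈(d−n−1)/(t(Γ)+1)⌉ + 3 ≤ reg(Γ) ≤ ⌈(d−n−1)/t(Γ)⌉ + 2, and let H be a hyperplane such that |Γ ∩ H| ≥ n+1 and reg(Γ ∩ H) < reg(Γ). Then t(Γ : H) = t(Γ). -/

import Mathlib

open MvPolynomial Filter
open scoped Classical

attribute [local instance] MvPolynomial.gradedAlgebra

noncomputable section

variable {K : Type} [Field K] {n : ℕ}

/-- The Hilbert function, in degree `m`, of the quotient of the homogeneous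
coordinate ring of `ℙ^n_K` by the ideal `I`. -/
def hilbF (I : Ideal (MvPolynomial (Fin (n+1)) K)) (m : ℕ) : ℕ :=
  Module.finrank K
    ((MvPolynomial.homogeneousSubmodule (Fin (n+1)) K m).map
      (Ideal.Quotient.mkₐ K I).toLinearMap)

/-- The irrelevant maximal ideal `(x_0, …, x_n)`. -/
def irrelevantIdeal (K : Type) [Field K] (n : ℕ) : Ideal (MvPolynomial (Fin (n+1)) K) :=
  Ideal.span (Set.range MvPolynomial.X)

/-- Saturation of a homogeneous ideal with respect to the irrelevant ideal. -/
def saturate (I : Ideal (MvPolynomial (Fin (n+1)) K)) : Ideal (MvPolynomial (Fin (n+1)) K) :=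
  ⨆ k : ℕ, Submodule.colon I ((irrelevantIdeal K n ^ k : Ideal (MvPolynomial (Fin (n+1)) K)) : Submodule (MvPolynomial (Fin (n+1)) K) (MvPolynomial (Fin (n+1)) K))

/-- `I` is the (saturated, homogeneous) ideal of a nonempty finite closed subscheme of
`ℙ^n`, i.e. its Hilbert function is eventually a positive constant. -/
structure IsFiniteSubscheme (I : Ideal (MvPolynomial (Fin (n+1)) K)) : Prop where
  homog : Ideal.IsHomogeneous (MvPolynomial.homogeneousSubmodule (Fin (n+1)) K) I
  saturated : saturate I = I
  finite : ∃ d : ℕ, 0 < d ∧ ∀ᶠ m : ℕ in atTop, hilbF I m = d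

/-- The degree (length) of the finite scheme with ideal `I` : the eventual value of
its Hilbert function. -/
def schemeDeg (I : Ideal (MvPolynomial (Fin (n+1)) K)) : ℕ :=
  if h : ∃ d : ℕ, ∀ᶠ m : ℕ in atTop, hilbF I m = d then h.choose else 0

/-- The Castelnuovo–Mumford regularity of the finite scheme with ideal `I` : the least
`p ≥ 1` such that the scheme is `(p-1)`-normal (for a finite scheme, `p`-regularity is
equivalent to `(p-1)`-normality). -/
def schemeReg (I : Ideal (MvPolynomial (Fin (n+1)) K)) : ℕ :=
  sInf {p : ℕ | 1 ≤ p ∧ ∀ m : ℕ, p - 1 ≤ m → hilbF I m = schemeDeg I}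

/-- `h¹(ℙ^n, I_Γ(q))` for a finite scheme `Γ` and `q ≥ 0`: the failure of `q`-normality,
`deg Γ - h_Γ(q)`. -/
def h1F (I : Ideal (MvPolynomial (Fin (n+1)) K)) (q : ℕ) : ℕ :=
  schemeDeg I - hilbF I q

/-- `J` is the ideal of a `t`-dimensional linear subspace of `ℙ^n`: it is generated by a
space of linear forms of codimension... i.e. of `K`-dimension `n - t`. -/
def IsLinearSubspace (J : Ideal (MvPolynomial (Fin (n+1)) K)) (t : ℕ) : Prop :=
  ∃ W : Submodule K (MvPolynomial (Fin (n+1)) K),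
    W ≤ MvPolynomial.homogeneousSubmodule (Fin (n+1)) K 1 ∧
    Module.finrank K W + t = n ∧
    J = Ideal.span (W : Set (MvPolynomial (Fin (n+1)) K))

/-- The ideal of the scheme-theoretic intersection (defined by the sum of the ideal
sheaves): the saturation of `I + J`. -/
def interIdeal (I J : Ideal (MvPolynomial (Fin (n+1)) K)) : Ideal (MvPolynomial (Fin (n+1)) K) :=
  saturate (I ⊔ J)

/-- The residual scheme `Γ : V`, where `V` is the hypersurface `{f = 0}`, is defined by
the colon ideal `(I_Γ : f)`. -/
def residualIdeal (I : Ideal (MvPolynomial (Fin (n+1)) K)) (f : MvPolynomial (Fin (n+1)) K) :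
    Ideal (MvPolynomial (Fin (n+1)) K) :=
  Submodule.colon I (Ideal.span {f})

/-- `Γ` admits a `(t+2)`-secant `t`-plane. -/
def HasSecantPlane (I : Ideal (MvPolynomial (Fin (n+1)) K)) (t : ℕ) : Prop :=
  ∃ J : Ideal (MvPolynomial (Fin (n+1)) K),
    IsLinearSubspace J t ∧ t + 2 ≤ schemeDeg (interIdeal I J)

/-- `t(Γ)`: the smallest `t` such that `Γ` admits a `(t+2)`-secant `t`-plane. -/
def tInv (I : Ideal (MvPolynomial (Fin (n+1)) K)) : ℕ :=
  sInf {t : ℕ | HasSecantPlane I t}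

/-- `Γ` is in linearly general position if `t(Γ) = n`. -/
def InLinGenPos (I : Ideal (MvPolynomial (Fin (n+1)) K)) : Prop :=
  tInv I = n

/-- `Γ ⊆ ℙ^n` is nondegenerate: `I(Γ)` contains no nonzero linear form. -/
def NondegenerateScheme (I : Ideal (MvPolynomial (Fin (n+1)) K)) : Prop :=
  Submodule.restrictScalars K I ⊓ MvPolynomial.homogeneousSubmodule (Fin (n+1)) K 1 = ⊥

/-- The (projective) dimension of the linear span `⟨Γ⟩` of the scheme with ideal `I`:
`n` minus the number of independent linear forms in `I`. -/
def spanDim (I : Ideal (MvPolynomial (Fin (n+1)) K)) : ℕ :=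
  n - Module.finrank K
    ↥(Submodule.restrictScalars K I ⊓ MvPolynomial.homogeneousSubmodule (Fin (n+1)) K 1)

/-- `Γ ∩ Λ` is nondegenerate as a subscheme of the `t`-plane `Λ`: it is contained in no
`(t-1)`-dimensional linear subspace of `Λ`. -/
def NondegenerateIn (I Λ : Ideal (MvPolynomial (Fin (n+1)) K)) (t : ℕ) : Prop :=
  ∀ J : Ideal (MvPolynomial (Fin (n+1)) K),
    IsLinearSubspace J (t - 1) → Λ ≤ J → ¬ J ≤ interIdeal I Λ

/-- `Γ ∩ Λ` is in linearly general position as a subscheme of the `t`-plane `Λ`: it has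
no `(s+2)`-secant `s`-plane inside `Λ` for any `s < t`. -/
def InLinGenPosIn (I Λ : Ideal (MvPolynomial (Fin (n+1)) K)) (t : ℕ) : Prop :=
  ∀ s : ℕ, s < t → ∀ J : Ideal (MvPolynomial (Fin (n+1)) K),
    IsLinearSubspace J s → Λ ≤ J → schemeDeg (interIdeal I J) ≤ s + 1

/-- `J` is the (saturated) homogeneous ideal of a rational normal curve of degree `t`
in `ℙ^n` : the curve is the image of `ℙ^1` under a parametrization by a basis-spanning
family of binary forms of degree `t`, and `J` is the vanishing ideal of (the affine cone
over) this image. -/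
def IsRNC (t : ℕ) (J : Ideal (MvPolynomial (Fin (n+1)) K)) : Prop :=
  ∃ p : Fin (n+1) → MvPolynomial (Fin 2) K,
    (∀ i, (p i).IsHomogeneous t) ∧
    Submodule.span K (Set.range p) = MvPolynomial.homogeneousSubmodule (Fin 2) K t ∧
    J = ⨅ x : Fin 2 → K,
      RingHom.ker (MvPolynomial.eval (fun i => MvPolynomial.eval x (p i)) :
        MvPolynomial (Fin (n+1)) K →+* K)

/-- `ρ(Γ)`: the maximal length of the intersection of `Γ` with a rational normal curve
(of degree `n`) in `ℙ^n`. -/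
def rhoInv (I : Ideal (MvPolynomial (Fin (n+1)) K)) : ℕ :=
  sSup {e : ℕ | ∃ J : Ideal (MvPolynomial (Fin (n+1)) K),
    IsRNC n J ∧ e = schemeDeg (interIdeal I J)}

/-- The (saturated homogeneous) vanishing ideal of a point of `ℙ^n`. -/
def pointIdeal (P : Projectivization K (Fin (n+1) → K)) : Ideal (MvPolynomial (Fin (n+1)) K) :=
  ⨅ c : K, RingHom.ker
    (MvPolynomial.eval (c • P.rep) : MvPolynomial (Fin (n+1)) K →+* K)

/-- The vanishing ideal of a finite set of points of `ℙ^n`. -/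
def idealOfFinset (S : Finset (Projectivization K (Fin (n+1) → K))) :
    Ideal (MvPolynomial (Fin (n+1)) K) :=
  ⨅ P ∈ S, pointIdeal P

/-- A finite set of points of `ℙ^n` is in uniform position if every subset `Y` has
Hilbert function `h_Y(ℓ) = min {|Y|, h_Γ(ℓ)}`. -/
def UniformPosition (S : Finset (Projectivization K (Fin (n+1) → K))) : Prop :=
  ∀ Y ⊆ S, ∀ ℓ : ℕ, hilbF (idealOfFinset Y) ℓ = min Y.card (hilbF (idealOfFinset S) ℓ)

end


section ResidualCounting

variable {K R : Type*} [Field K] [CommRing R] [Algebra K R]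

/-- The residual ideal `(a : w)`. -/
def colonBy (a : Ideal R) (w : R) : Ideal R := Submodule.comap (LinearMap.mulLeft R w) a

theorem mem_colonBy {a : Ideal R} {w x : R} : x ∈ colonBy a w ↔ w * x ∈ a := Iff.rfl

theorem le_colonBy (a : Ideal R) (w : R) : a ≤ colonBy a w := fun _ hx => a.mul_mem_left w hx

variable (K) in
theorem finrank_quotient_le_of_le {a b : Ideal R} [FiniteDimensional K (R ⧸ a)] (h : a ≤ b) :
    Module.finrank K (R ⧸ b) ≤ Module.finrank K (R ⧸ a) :=
  LinearMap.finrank_le_finrank_of_surjective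
    (f := (Ideal.Quotient.factorₐ K h).toLinearMap) (Ideal.Quotient.factor_surjective h)

variable (K) in
theorem finiteDimensional_quotient_of_le {a b : Ideal R} [FiniteDimensional K (R ⧸ a)]
    (h : a ≤ b) : FiniteDimensional K (R ⧸ b) :=
  FiniteDimensional.of_surjective
    (f := (Ideal.Quotient.factorₐ K h).toLinearMap) (Ideal.Quotient.factor_surjective h)

variable (K) in
theorem finrank_quotient_lt_of_lt {a b : Ideal R} [FiniteDimensional K (R ⧸ a)] (h : a < b) :
    Module.finrank K (R ⧸ b) < Module.finrank K (R ⧸ a) := by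
  refine lt_of_le_of_ne (finrank_quotient_le_of_le K h.le) fun he => h.not_ge fun x hx => ?_
  have := finiteDimensional_quotient_of_le K h.le
  have hinj := (LinearMap.injective_iff_surjective_of_finrank_eq_finrank he.symm
    (f := (Ideal.Quotient.factorₐ K h.le).toLinearMap)).2 (Ideal.Quotient.factor_surjective h.le)
  rw [← Ideal.Quotient.eq_zero_iff_mem]
  apply hinj
  simpa using Ideal.Quotient.eq_zero_iff_mem.2 hx

variable (K) in
/-- The degree of a finite scheme is the sum of the degrees of its intersection with a
hypersurface and of the residual scheme. -/
theorem finrank_colonBy_add (a : Ideal R) [FiniteDimensional K (R ⧸ a)] (w : R) :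
    Module.finrank K (R ⧸ colonBy a w) + Module.finrank K (R ⧸ (a ⊔ Ideal.span {w})) =
      Module.finrank K (R ⧸ a) := by
  let g : (R ⧸ colonBy a w) →ₗ[R] R ⧸ a := (colonBy a w).mapQ a (LinearMap.mulLeft R w) le_rfl
  let p : (R ⧸ a) →ₐ[K] R ⧸ (a ⊔ Ideal.span {w}) := Ideal.Quotient.factorₐ K le_sup_left
  have hg : Function.Injective g := by
    rw [← LinearMap.ker_eq_bot, LinearMap.ker_eq_bot']
    intro x hx
    obtain ⟨x, rfl⟩ := Ideal.Quotient.mk_surjective x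
    have hx' : w * x ∈ a := Ideal.Quotient.eq_zero_iff_mem.1 hx
    exact Ideal.Quotient.eq_zero_iff_mem.2 hx'
  have hp : Function.Surjective p := Ideal.Quotient.factor_surjective le_sup_left
  have hrange : LinearMap.ker p.toLinearMap = LinearMap.range (g.restrictScalars K) := by
    ext x
    obtain ⟨x, rfl⟩ := Ideal.Quotient.mk_surjective x
    constructor
    · intro hx
      have hx' : x ∈ a ⊔ Ideal.span {w} := Ideal.Quotient.eq_zero_iff_mem.1 hx
      obtain ⟨y, hy, z, hz, rfl⟩ := Submodule.mem_sup.1 hx'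
      obtain ⟨c, rfl⟩ := Ideal.mem_span_singleton'.1 hz
      refine ⟨Ideal.Quotient.mk _ c, ?_⟩
      change Ideal.Quotient.mk a (w * c) = _
      rw [Ideal.Quotient.eq]
      have : w * c - (y + c * w) = -y := by ring
      rw [this]
      exact a.neg_mem hy
    · rintro ⟨y, hy⟩
      obtain ⟨y, rfl⟩ := Ideal.Quotient.mk_surjective y
      rw [← hy]
      change Ideal.Quotient.mk (a ⊔ Ideal.span {w}) (w * y) = 0
      rw [Ideal.Quotient.eq_zero_iff_mem]
      exact Ideal.mem_sup_right (Ideal.mul_mem_right _ _ (Ideal.mem_span_singleton_self w))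
  have h1 := LinearMap.finrank_range_add_finrank_ker p.toLinearMap
  rw [hrange, LinearMap.finrank_range_of_inj (f := g.restrictScalars K) hg,
    LinearMap.range_eq_top.2 hp, finrank_top] at h1
  omega

/-- A subspace of `R` surjects onto `R ⧸ a` when its `(k+1)`-st power does so modulo `a + (w)`
and its `k`-th power does so modulo `(a : w)`. -/
theorem pow_succ_sup_eq_top {V : Submodule K R} {a : Ideal R} {w : R} (hw : w ∈ V) {k : ℕ}
    (h1 : V ^ k ⊔ (colonBy a w).restrictScalars K = ⊤)
    (h2 : V ^ (k + 1) ⊔ (a ⊔ Ideal.span {w}).restrictScalars K = ⊤) :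
    V ^ (k + 1) ⊔ a.restrictScalars K = ⊤ := by
  rw [eq_top_iff]
  intro x _
  obtain ⟨y, hy, z, hz, rfl⟩ := Submodule.mem_sup.1 (h2 ▸ Submodule.mem_top : x ∈ _)
  obtain ⟨b, hb, c, hc, rfl⟩ := Submodule.mem_sup.1 (Submodule.restrictScalars_mem K _ _ |>.1 hz)
  obtain ⟨r, rfl⟩ := Ideal.mem_span_singleton'.1 hc
  obtain ⟨u, hu, s, hs, rfl⟩ := Submodule.mem_sup.1 (h1 ▸ Submodule.mem_top : r ∈ _)
  have hs' : w * s ∈ a := hs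
  have huw : u * w ∈ V ^ (k + 1) := by
    rw [pow_succ]; exact Submodule.mul_mem_mul hu hw
  refine Submodule.mem_sup.2 ⟨y + u * w, Submodule.add_mem _ hy huw, b + w * s,
    a.add_mem hb hs', by ring⟩

theorem pow_sup_eq_top {V : Submodule K R} {a : Ideal R}
    (h : V ⊔ a.restrictScalars K = ⊤) (k : ℕ) :
    V ^ (k + 1) ⊔ a.restrictScalars K = ⊤ := by
  induction k with
  | zero => simpa using h
  | succ k ih =>
    rw [eq_top_iff]
    intro x _
    obtain ⟨b, hb, c, hc, hbc⟩ := Submodule.mem_sup.1 (ih ▸ Submodule.mem_top : (1 : R) ∈ _)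
    obtain ⟨y, hy, z, hz, rfl⟩ := Submodule.mem_sup.1 (h ▸ Submodule.mem_top : x ∈ _)
    refine Submodule.mem_sup.2 ⟨b * y, ?_, c * y + z, ?_, by linear_combination y * hbc⟩
    · rw [pow_succ]; exact Submodule.mul_mem_mul hb hy
    · exact a.add_mem (a.mul_mem_right _ hc) hz

variable [IsAlgClosed K] [IsNoetherianRing R]

/-- A subspace of codimension one can be chosen so that the ideal it generates modulo `a` drops. -/
theorem exists_codim_one_lt {a : Ideal R} [FiniteDimensional K (R ⧸ a)] {W : Submodule K R}
    [FiniteDimensional K W] (hW : ¬ W ≤ a.restrictScalars K) :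
    ∃ W' ≤ W, Module.finrank K W' + 1 = Module.finrank K W ∧
      a ⊔ Ideal.span (W' : Set R) < a ⊔ Ideal.span (W : Set R) := by
  have hlt : a < a ⊔ Ideal.span (W : Set R) := by
    refine lt_of_le_of_ne le_sup_left fun h => hW fun x hx => ?_
    change x ∈ a
    rw [h]
    exact Ideal.mem_sup_right (Ideal.subset_span hx)
  obtain ⟨P, haP, hcov⟩ := exists_le_covBy_of_lt hlt
  have hWP : ∃ w ∈ W, w ∉ P := by
    by_contra! h
    exact hcov.lt.not_ge (sup_le haP (Ideal.span_le.2 h))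
  obtain ⟨w, hw, hwP⟩ := hWP
  have hwN : w ∈ a ⊔ Ideal.span (W : Set R) := Ideal.mem_sup_right (Ideal.subset_span hw)
  have hgen : ∀ y ∈ a ⊔ Ideal.span (W : Set R), y ∉ P →
      ∀ x ∈ a ⊔ Ideal.span (W : Set R), ∃ r, x - r * y ∈ P := by
    intro y hy hyP x hx
    have hPy : P ⊔ Ideal.span {y} = a ⊔ Ideal.span (W : Set R) := by
      refine (hcov.eq_or_eq le_sup_left (sup_le hcov.le ?_)).resolve_left fun h => hyP ?_
      · simpa [Ideal.span_le] using hy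
      · rw [← h]; exact Ideal.mem_sup_right (Ideal.mem_span_singleton_self y)
    rw [← hPy] at hx
    obtain ⟨p, hp, z, hz, rfl⟩ := Submodule.mem_sup.1 hx
    obtain ⟨r, rfl⟩ := Ideal.mem_span_singleton'.1 hz
    exact ⟨r, by simpa using hp⟩
  have hmax : (colonBy P w).IsMaximal := by
    rw [Ideal.isMaximal_iff]
    refine ⟨by simpa [mem_colonBy] using hwP, fun J x hJ hx hxJ => ?_⟩
    obtain ⟨r, hr⟩ := hgen (w * x) (Ideal.mul_mem_right _ _ hwN) hx w hwN
    have h1 : 1 - r * x ∈ colonBy P w := by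
      rw [mem_colonBy]; convert hr using 1; ring
    have := J.add_mem (hJ h1) (J.mul_mem_left r hxJ)
    simpa using this
  have hfin : FiniteDimensional K (R ⧸ colonBy P w) :=
    finiteDimensional_quotient_of_le K (haP.trans (le_colonBy P w))
  let _ : Field (R ⧸ colonBy P w) := Ideal.Quotient.field _
  have hscal : ∀ x ∈ a ⊔ Ideal.span (W : Set R), ∃ c : K, x - c • w ∈ P := by
    intro x hx
    obtain ⟨r, hr⟩ := hgen w hwN hwP x hx
    obtain ⟨c, hc⟩ := (IsAlgClosed.algebraMap_bijective_of_isIntegral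
      (k := K) (K := R ⧸ colonBy P w)).2 (Ideal.Quotient.mk _ r)
    have hc' : algebraMap K R c - r ∈ colonBy P w := by
      rw [← Ideal.Quotient.eq]; exact hc
    refine ⟨c, ?_⟩
    have := P.sub_mem hr (mem_colonBy.1 hc')
    convert this using 1
    rw [Algebra.smul_def]; ring
  let W' : Submodule K R := W ⊓ P.restrictScalars K
  have hW'W : W' ≤ W := inf_le_left
  have : FiniteDimensional K W' := Submodule.finiteDimensional_of_le hW'W
  refine ⟨W', hW'W, ?_, ?_⟩
  · have hsup : W' ⊔ K ∙ w = W := by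
      refine le_antisymm (sup_le hW'W (by simpa using hw)) fun x hx => ?_
      obtain ⟨c, hc⟩ := hscal x (Ideal.mem_sup_right (Ideal.subset_span hx))
      refine Submodule.mem_sup.2 ⟨x - c • w, ⟨W.sub_mem hx (W.smul_mem c hw), hc⟩, c • w,
        Submodule.smul_mem _ _ (Submodule.mem_span_singleton_self w), by simp⟩
    have hinf : W' ⊓ K ∙ w = ⊥ := by
      rw [eq_bot_iff]
      rintro x ⟨hx, hxw⟩
      obtain ⟨c, rfl⟩ := Submodule.mem_span_singleton.1 hxw
      by_cases hc : c = 0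
      · simp [hc]
      · have : c⁻¹ • c • w ∈ P.restrictScalars K := Submodule.smul_mem _ _ hx.2
        rw [inv_smul_smul₀ hc] at this
        exact absurd this hwP
    have h := Submodule.finrank_sup_add_finrank_inf_eq W' (K ∙ w)
    rw [hsup, hinf, finrank_bot, finrank_span_singleton (by rintro rfl; simp at hwP)] at h
    omega
  · refine lt_of_le_of_lt (sup_le haP (Ideal.span_le.2 fun x hx => hx.2)) hcov.lt

/-- There is a subspace of any codimension `c`, as long as `c` is at most the dimension of the image
of `V` modulo `a`, that generates an ideal of colength at least `c` modulo `a`. -/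
theorem exists_codim_le_finrank {a : Ideal R} [FiniteDimensional K (R ⧸ a)] {V : Submodule K R}
    [FiniteDimensional K V] (c : ℕ)
    (hc : Module.finrank K (V ⊓ a.restrictScalars K : Submodule K R) + c ≤ Module.finrank K V) :
    ∃ W ≤ V, Module.finrank K W + c = Module.finrank K V ∧
      c ≤ Module.finrank K (R ⧸ (a ⊔ Ideal.span (W : Set R))) := by
  induction c with
  | zero => exact ⟨V, le_rfl, rfl, Nat.zero_le _⟩
  | succ c ih =>
    obtain ⟨W, hWV, hW, hcW⟩ := ih (by omega)
    have : FiniteDimensional K W := Submodule.finiteDimensional_of_le hWV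
    have hWa : ¬ W ≤ a.restrictScalars K := fun h => by
      have := Submodule.finrank_mono (le_inf hWV h)
      omega
    obtain ⟨W', hW', hdim, hlt⟩ := exists_codim_one_lt hWa
    have := finiteDimensional_quotient_of_le K (le_sup_left : a ≤ a ⊔ Ideal.span (W' : Set R))
    have := finrank_quotient_lt_of_lt K hlt
    exact ⟨W', hW'.trans hWV, by omega, by omega⟩

/-- If the subspaces of `V` of codimension `c ≤ t` generate ideals of colength at most `c`
modulo `a` and `a` has colength at most `k * t + 1`, then `V ^ k` surjects onto `R ⧸ a`. -/
theorem pow_sup_eq_top_of_finrank_le (V : Submodule K R) [FiniteDimensional K V] (t : ℕ) (k : ℕ) :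
    ∀ (a : Ideal R) [FiniteDimensional K (R ⧸ a)],
      (∀ W ≤ V, ∀ c ≤ t, Module.finrank K W + c = Module.finrank K V →
        Module.finrank K (R ⧸ (a ⊔ Ideal.span (W : Set R))) ≤ c) →
      Module.finrank K (R ⧸ a) ≤ k * t + 1 → V ^ k ⊔ a.restrictScalars K = ⊤ := by
  induction k with
  | zero =>
    intro a _ _ hd
    by_cases ha : a = ⊤
    · simp [ha]
    have : Nontrivial (R ⧸ a) := Ideal.Quotient.nontrivial_iff.2 ha
    have h1 : Module.finrank K (R ⧸ a) = 1 := by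
      have := Module.finrank_pos (R := K) (M := R ⧸ a)
      omega
    rw [eq_top_iff]
    intro x _
    obtain ⟨c, hc⟩ := (finrank_eq_one_iff_of_nonzero' (1 : R ⧸ a) one_ne_zero).1 h1
      (Ideal.Quotient.mk a x)
    refine Submodule.mem_sup.2 ⟨algebraMap K R c, ?_, x - algebraMap K R c, ?_, by ring⟩
    · simp [Submodule.mem_one]
    · change _ ∈ a
      rw [← Ideal.Quotient.eq, ← hc, Algebra.smul_def, mul_one]
      rfl
  | succ k ihk =>
    intro a _ h hd
    induction hN : Module.finrank K (R ⧸ a) using Nat.strong_induction_on generalizing a with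
    | _ N ihN =>
    have hmono : ∀ b : Ideal R, a ≤ b → ∀ W ≤ V, ∀ c ≤ t,
        Module.finrank K W + c = Module.finrank K V →
        Module.finrank K (R ⧸ (b ⊔ Ideal.span (W : Set R))) ≤ c := by
      intro b hab W hW c hc hWc
      have := finiteDimensional_quotient_of_le K (le_sup_left : a ≤ a ⊔ Ideal.span (W : Set R))
      exact (finrank_quotient_le_of_le K (sup_le_sup_right hab _)).trans (h W hW c hc hWc)
    have hker : (V ⊓ a.restrictScalars K : Submodule K R) ≤ V := inf_le_left
    have hkerle := Submodule.finrank_mono hker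
    by_cases hV : Module.finrank K V ≤
        Module.finrank K (V ⊓ a.restrictScalars K : Submodule K R) + t
    · apply pow_sup_eq_top
      have hle := h _ hker (Module.finrank K V -
        Module.finrank K (V ⊓ a.restrictScalars K : Submodule K R)) (by omega) (by omega)
      rw [sup_eq_left.2 (Ideal.span_le.2 fun x hx => hx.2)] at hle
      let p := (Ideal.Quotient.mkₐ K a).toLinearMap
      have hrank : Module.finrank K (V.map p) +
          Module.finrank K (V ⊓ a.restrictScalars K : Submodule K R) = Module.finrank K V := by
        have h1 := LinearMap.finrank_range_add_finrank_ker (p.domRestrict V)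
        rw [LinearMap.range_domRestrict] at h1
        have h2 : (LinearMap.ker (p.domRestrict V)).map V.subtype = V ⊓ a.restrictScalars K := by
          ext x
          simp [p, Ideal.Quotient.eq_zero_iff_mem, and_comm]
        rw [← h2, Submodule.finrank_map_subtype_eq]
        exact h1
      have htop : V.map p = ⊤ := by
        apply Submodule.eq_top_of_finrank_eq
        have := Submodule.finrank_le (V.map p)
        omega
      rw [eq_top_iff]
      intro x _
      obtain ⟨v, hv, hvx⟩ := (htop ▸ Submodule.mem_top : p x ∈ V.map p)
      refine Submodule.mem_sup.2 ⟨v, hv, x - v, ?_, by ring⟩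
      change _ ∈ a
      rw [← Ideal.Quotient.eq]
      exact hvx.symm
    · obtain ⟨W, hWV, hW, htW⟩ := exists_codim_le_finrank (a := a) (V := V) t (by omega)
      have : FiniteDimensional K W := Submodule.finiteDimensional_of_le hWV
      have hWa : ¬ W ≤ a.restrictScalars K := fun h => by
        have := Submodule.finrank_mono (le_inf hWV h)
        omega
      obtain ⟨w, hw, hwa⟩ := Set.not_subset.1 hWa
      have hw1 : a < a ⊔ Ideal.span {w} := by
        refine lt_of_le_of_ne le_sup_left fun he => hwa ?_
        change w ∈ a
        rw [he]
        exact Ideal.mem_sup_right (Ideal.mem_span_singleton_self w)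
      have := finiteDimensional_quotient_of_le K hw1.le
      have := finiteDimensional_quotient_of_le K (le_colonBy a w)
      have hadd := finrank_colonBy_add K a w
      have hlt := finrank_quotient_lt_of_lt K hw1
      have htw : t ≤ Module.finrank K (R ⧸ (a ⊔ Ideal.span {w})) :=
        htW.trans (finrank_quotient_le_of_le K (sup_le_sup_left (Ideal.span_mono (by simpa)) a))
      have hk : (k + 1) * t + 1 = k * t + 1 + t := by ring
      refine pow_succ_sup_eq_top (hWV hw) (ihk _ (hmono _ (le_colonBy a w)) (by omega)) ?_
      exact ihN _ (hN ▸ hlt) _ (hmono _ hw1.le) (by omega) rfl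

end ResidualCounting

section Homogeneous

variable {K : Type} [Field K] {n : ℕ}

theorem homogeneousComponent_zero_linear_mul {f : MvPolynomial (Fin (n+1)) K}
    (hf : f.IsHomogeneous 1) (p : MvPolynomial (Fin (n+1)) K) :
    homogeneousComponent 0 (f * p) = 0 := by
  conv_lhs => rw [← sum_homogeneousComponent p]
  rw [Finset.mul_sum, map_sum]
  refine Finset.sum_eq_zero fun i _ => ?_
  rw [homogeneousComponent_of_mem (hf.mul (homogeneousComponent_isHomogeneous i p)),
    if_neg (by omega)]

theorem homogeneousComponent_succ_linear_mul {f : MvPolynomial (Fin (n+1)) K}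
    (hf : f.IsHomogeneous 1) (p : MvPolynomial (Fin (n+1)) K) (j : ℕ) :
    homogeneousComponent (j + 1) (f * p) = f * homogeneousComponent j p := by
  conv_lhs => rw [← sum_homogeneousComponent p]
  rw [Finset.mul_sum, map_sum]
  have h : ∀ i, homogeneousComponent (j + 1) (f * homogeneousComponent i p) =
      if i = j then f * homogeneousComponent i p else 0 := by
    intro i
    rw [homogeneousComponent_of_mem (hf.mul (homogeneousComponent_isHomogeneous i p))]
    exact if_congr (by omega) rfl rfl
  simp_rw [h]
  rw [Finset.sum_ite_eq' (Finset.range (p.totalDegree + 1)) j fun i => f * homogeneousComponent i p]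
  split_ifs with hj
  · rfl
  · rw [homogeneousComponent_eq_zero j p (by simpa using hj), mul_zero]

/-- A homogeneous element of `Q + (l - 1)` lies in `Q` after multiplication by a power of `l`. -/
theorem exists_pow_mul_mem {Q : Ideal (MvPolynomial (Fin (n+1)) K)}
    (hQ : Q.IsHomogeneous (homogeneousSubmodule (Fin (n+1)) K))
    {l : MvPolynomial (Fin (n+1)) K} (hl : l.IsHomogeneous 1) {m : ℕ}
    {F : MvPolynomial (Fin (n+1)) K} (hF : F.IsHomogeneous m)
    (hFQ : F ∈ Q ⊔ Ideal.span {l - 1}) : ∃ k, l ^ k * F ∈ Q := by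
  obtain ⟨q, hq, z, hz, rfl⟩ := Submodule.mem_sup.1 hFQ
  obtain ⟨g, rfl⟩ := Ideal.mem_span_singleton'.1 hz
  let T (N : ℕ) (p : MvPolynomial (Fin (n+1)) K) : MvPolynomial (Fin (n+1)) K :=
    ∑ j ∈ Finset.range (N + 1), l ^ (N - j) * homogeneousComponent j p
  have hTadd : ∀ N p p', T N (p + p') = T N p + T N p' := fun N p p' => by
    simp only [T, map_add, mul_add, Finset.sum_add_distrib]
  have hTsub : ∀ N p p', T N (p - p') = T N p - T N p' := fun N p p' => by
    simp only [T, map_sub, mul_sub, Finset.sum_sub_distrib]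
  have hTl : ∀ N p, T N (l * p) = T N p - homogeneousComponent N p := fun N p => by
    simp only [T]
    rw [Finset.sum_range_succ', homogeneousComponent_zero_linear_mul hl, mul_zero, add_zero,
      Finset.sum_range_succ, Nat.sub_self, pow_zero, one_mul, add_sub_cancel_right]
    refine Finset.sum_congr rfl fun j hj => ?_
    have hj' := Finset.mem_range.1 hj
    rw [homogeneousComponent_succ_linear_mul hl, ← mul_assoc, ← pow_succ]
    congr 2
    omega
  let N := m + g.totalDegree + 1
  refine ⟨N - m, ?_⟩
  have hTF : T N (q + g * (l - 1)) = l ^ (N - m) * (q + g * (l - 1)) := by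
    simp only [T]
    rw [Finset.sum_eq_single m]
    · rw [homogeneousComponent_of_mem hF, if_pos rfl]
    · intro j _ hj
      rw [homogeneousComponent_of_mem hF, if_neg hj, mul_zero]
    · intro h
      simp only [Finset.mem_range, N] at h
      omega
  have hg : g * (l - 1) = l * g - g := by ring
  rw [← hTF, hTadd, hg, hTsub, hTl, homogeneousComponent_eq_zero N g (by omega)]
  simp only [sub_zero, sub_self, add_zero]
  exact Q.sum_mem fun j _ => Q.mul_mem_left _ (homogeneousComponent_mem_of_mem hQ hq j)

theorem irrelevantIdeal_pow (k : ℕ) :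
    irrelevantIdeal K n ^ k =
      Ideal.span (homogeneousSubmodule (Fin (n+1)) K k : Set (MvPolynomial (Fin (n+1)) K)) := by
  apply le_antisymm
  · induction k with
    | zero =>
      rw [pow_zero, Ideal.one_eq_top]
      exact ((Ideal.eq_top_iff_one _).2 (Ideal.subset_span (isHomogeneous_one (Fin (n+1)) K))).ge
    | succ k ih =>
      rw [pow_succ]
      refine (Ideal.mul_mono_left ih).trans ?_
      rw [irrelevantIdeal, Ideal.span_mul_span', Ideal.span_le]
      rintro _ ⟨a, ha, _, ⟨i, rfl⟩, rfl⟩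
      exact Ideal.subset_span (IsHomogeneous.mul ha (isHomogeneous_X K i))
  · rw [Ideal.span_le]
    change homogeneousSubmodule (Fin (n+1)) K k ≤ (irrelevantIdeal K n ^ k).restrictScalars K
    rw [← homogeneousSubmodule_one_pow]
    induction k with
    | zero => simp
    | succ k ih =>
      rw [pow_succ, Submodule.mul_le]
      intro a ha b hb
      have hb' : homogeneousSubmodule (Fin (n+1)) K 1 ≤ (irrelevantIdeal K n).restrictScalars K := by
        rw [homogeneousSubmodule_one_eq_span_X, Submodule.span_le]
        exact Ideal.subset_span
      have ha' : a ∈ irrelevantIdeal K n ^ k := ih ha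
      change a * b ∈ irrelevantIdeal K n ^ (k + 1)
      rw [pow_succ]
      exact Ideal.mul_mem_mul ha' (hb' hb)

theorem mem_saturate {Q : Ideal (MvPolynomial (Fin (n+1)) K)} {F : MvPolynomial (Fin (n+1)) K} :
    F ∈ saturate Q ↔ ∃ k, ∀ h ∈ homogeneousSubmodule (Fin (n+1)) K k, h * F ∈ Q := by
  have hdir : Directed (· ≤ ·) fun k : ℕ => Submodule.colon Q
      ((irrelevantIdeal K n ^ k : Ideal (MvPolynomial (Fin (n+1)) K)) :
        Set (MvPolynomial (Fin (n+1)) K)) := by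
    apply Monotone.directed_le
    intro i j hij x hx
    rw [Submodule.mem_colon] at hx ⊢
    exact fun s hs => hx s (Ideal.pow_le_pow_right hij hs)
  rw [saturate, Submodule.mem_iSup_of_directed _ hdir]
  refine exists_congr fun k => ?_
  rw [irrelevantIdeal_pow, Submodule.mem_colon]
  constructor
  · intro h x hx
    rw [mul_comm]
    exact h x (Ideal.subset_span hx)
  · intro h s hs
    change s ∈ Ideal.span _ at hs
    rw [smul_eq_mul]
    induction hs using Submodule.span_induction with
    | mem x hx => rw [mul_comm]; exact h x hx
    | zero => simp
    | add x y _ _ hx hy => rw [mul_add]; exact Q.add_mem hx hy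
    | smul a x _ hx =>
      rw [smul_eq_mul, mul_left_comm]
      exact Q.mul_mem_left _ hx

theorem exists_linear_form_regular [Infinite K] {I : Ideal (MvPolynomial (Fin (n+1)) K)}
    (hI : saturate I = I) :
    ∃ l : MvPolynomial (Fin (n+1)) K, l.IsHomogeneous 1 ∧ ∀ g, l * g ∈ I → g ∈ I := by
  let R := MvPolynomial (Fin (n+1)) K
  have hfin := associatedPrimes.finite R (R ⧸ I)
  let V := homogeneousSubmodule (Fin (n+1)) K 1
  let s : Finset (Submodule K V) :=
    hfin.toFinset.image fun p => (p.restrictScalars K).comap V.subtype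
  have hs : ⊤ ∉ s := by
    intro h
    obtain ⟨p, hp, hpt⟩ := Finset.mem_image.1 h
    have hp' : IsAssociatedPrime p (R ⧸ I) := hfin.mem_toFinset.1 hp
    rw [isAssociatedPrime_iff] at hp'
    obtain ⟨hprime, x, hx⟩ := hp'
    obtain ⟨x, rfl⟩ := Ideal.Quotient.mk_surjective x
    apply hprime.ne_top
    rw [Ideal.eq_top_iff_one, hx, Submodule.mem_colon_singleton, one_smul, Submodule.mem_bot,
      Ideal.Quotient.eq_zero_iff_mem, ← hI, mem_saturate]
    refine ⟨1, fun h hh => ?_⟩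
    have hhp : (⟨h, hh⟩ : V) ∈ (p.restrictScalars K).comap V.subtype := hpt ▸ Submodule.mem_top
    have hhp' : h ∈ p := hhp
    rw [hx, Submodule.mem_colon_singleton, Submodule.mem_bot] at hhp'
    exact Ideal.Quotient.eq_zero_iff_mem.1 hhp'
  obtain ⟨l, hl⟩ := (Set.ne_univ_iff_exists_notMem _).1
    (Subspace.biUnion_ne_univ_of_top_notMem hs)
  refine ⟨l, l.2, fun g hg => ?_⟩
  by_contra hgI
  have hmem : (l : R) ∈ ⋃ p ∈ associatedPrimes R (R ⧸ I), (p : Set R) := by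
    rw [biUnion_associatedPrimes_eq_zero_divisors]
    exact ⟨Ideal.Quotient.mk I g, mt Ideal.Quotient.eq_zero_iff_mem.1 hgI,
      Ideal.Quotient.eq_zero_iff_mem.2 hg⟩
  obtain ⟨p, hp, hlp⟩ := Set.mem_iUnion₂.1 hmem
  exact hl (Set.mem_iUnion₂.2 ⟨(p.restrictScalars K).comap V.subtype,
    Finset.mem_image_of_mem _ (hfin.mem_toFinset.2 hp), hlp⟩)

theorem finiteDimensional_homogeneousSubmodule (m : ℕ) :
    FiniteDimensional K (homogeneousSubmodule (Fin (n+1)) K m) :=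
  Module.Finite.iff_fg.2 (homogeneousSubmodule_fg _ _ m)

theorem finrank_homogeneousSubmodule_one :
    Module.finrank K (homogeneousSubmodule (Fin (n+1)) K 1) = n + 1 := by
  rw [homogeneousSubmodule_one_eq_span_X, finrank_span_eq_card (linearIndependent_X _ _)]
  simp

theorem finrank_map_congr {E E₁ E₂ : Type*} [AddCommGroup E] [Module K E]
    [AddCommGroup E₁] [Module K E₁] [AddCommGroup E₂] [Module K E₂]
    (S : Submodule K E) (f : E →ₗ[K] E₁) (g : E →ₗ[K] E₂)
    (h : ∀ x ∈ S, f x = 0 ↔ g x = 0) :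
    Module.finrank K (S.map f) = Module.finrank K (S.map g) := by
  rw [← LinearMap.range_domRestrict, ← LinearMap.range_domRestrict]
  have hk : LinearMap.ker (f.domRestrict S) = LinearMap.ker (g.domRestrict S) := by
    ext ⟨x, hx⟩
    exact h x hx
  exact (((f.domRestrict S).quotKerEquivRange.symm.trans
    (Submodule.quotEquivOfEq _ _ hk)).trans (g.domRestrict S).quotKerEquivRange).finrank_eq

/-- The hyperplane `l = 0` misses the scheme with ideal `I`: the linear form `l` is a nonzerodivisor
modulo `I`, and multiplication by `l` is onto modulo `I` in large degrees. -/
structure IsTransversal (I : Ideal (MvPolynomial (Fin (n+1)) K))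
    (l : MvPolynomial (Fin (n+1)) K) : Prop where
  homog : l.IsHomogeneous 1
  regular : ∀ g, l * g ∈ I → g ∈ I
  surj : ∃ m₀, ∀ m ≥ m₀, ∀ h ∈ homogeneousSubmodule (Fin (n+1)) K (m + 1),
    ∃ g ∈ homogeneousSubmodule (Fin (n+1)) K m, h - l * g ∈ I

theorem IsFiniteSubscheme.exists_isTransversal [Infinite K]
    {I : Ideal (MvPolynomial (Fin (n+1)) K)} (hI : IsFiniteSubscheme I) :
    ∃ l, IsTransversal I l := by
  obtain ⟨l, hl, hreg⟩ := exists_linear_form_regular hI.saturated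
  obtain ⟨d, -, hd⟩ := hI.finite
  obtain ⟨m₀, hm₀⟩ := eventually_atTop.1 hd
  refine ⟨l, hl, hreg, m₀, fun m hm h hh => ?_⟩
  let q := (Ideal.Quotient.mkₐ K I).toLinearMap
  have hle : ((homogeneousSubmodule (Fin (n+1)) K m).map (LinearMap.mulLeft K l)).map q ≤
      (homogeneousSubmodule (Fin (n+1)) K (m + 1)).map q := by
    apply Submodule.map_mono
    rintro _ ⟨g, hg, rfl⟩
    rw [add_comm m 1]
    exact hl.mul hg
  have hdim : Module.finrank K
      (((homogeneousSubmodule (Fin (n+1)) K m).map (LinearMap.mulLeft K l)).map q) =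
      Module.finrank K ((homogeneousSubmodule (Fin (n+1)) K (m + 1)).map q) := by
    rw [← Submodule.map_comp,
      finrank_map_congr _ (q ∘ₗ LinearMap.mulLeft K l) q]
    · exact (hm₀ m hm).trans (hm₀ (m + 1) (by omega)).symm
    · intro x _
      change Ideal.Quotient.mk I (l * x) = 0 ↔ Ideal.Quotient.mk I x = 0
      rw [Ideal.Quotient.eq_zero_iff_mem, Ideal.Quotient.eq_zero_iff_mem]
      exact ⟨hreg x, I.mul_mem_left l⟩
  have := finiteDimensional_homogeneousSubmodule (K := K) (n := n) (m + 1)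
  have heq := Submodule.eq_of_le_of_finrank_eq hle hdim
  obtain ⟨_, ⟨g, hg, rfl⟩, hgh⟩ := (heq ▸ Submodule.mem_map_of_mem hh : q h ∈ _)
  exact ⟨g, hg, Ideal.Quotient.eq.1 hgh.symm⟩

namespace IsTransversal

variable {I : Ideal (MvPolynomial (Fin (n+1)) K)} {l : MvPolynomial (Fin (n+1)) K}

theorem surj_pow (hl : IsTransversal I l) :
    ∃ m₀, ∀ m ≥ m₀, ∀ k, ∀ h ∈ homogeneousSubmodule (Fin (n+1)) K (m + k),
      ∃ g ∈ homogeneousSubmodule (Fin (n+1)) K m, h - l ^ k * g ∈ I := by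
  obtain ⟨m₀, hm₀⟩ := hl.surj
  refine ⟨m₀, fun m hm k => ?_⟩
  induction k with
  | zero => exact fun h hh => ⟨h, hh, by simp⟩
  | succ k ih =>
    intro h hh
    obtain ⟨g, hg, hgI⟩ := hm₀ (m + k) (by omega) h hh
    obtain ⟨g', hg', hgI'⟩ := ih g hg
    refine ⟨g', hg', ?_⟩
    have := I.add_mem hgI (I.mul_mem_left l hgI')
    convert this using 1
    ring

theorem mem_saturate_iff (hl : IsTransversal I l) {Q : Ideal (MvPolynomial (Fin (n+1)) K)}
    (hQ : Q.IsHomogeneous (homogeneousSubmodule (Fin (n+1)) K)) (hIQ : I ≤ Q) {m : ℕ}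
    {F : MvPolynomial (Fin (n+1)) K} (hF : F.IsHomogeneous m) :
    F ∈ saturate Q ↔ F ∈ Q ⊔ Ideal.span {l - 1} := by
  constructor
  · intro h
    obtain ⟨k, hk⟩ := mem_saturate.1 h
    have hlk : l ^ k ∈ homogeneousSubmodule (Fin (n+1)) K k := by
      simpa using hl.homog.pow k
    have h1 : (l ^ k - 1) * F ∈ Ideal.span {l - 1} :=
      Ideal.mul_mem_right _ _ (Ideal.mem_span_singleton.2 (sub_one_dvd_pow_sub_one l k))
    have := (Q ⊔ Ideal.span {l - 1}).sub_mem (Ideal.mem_sup_left (hk _ hlk))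
      (Ideal.mem_sup_right h1)
    convert this using 1
    ring
  · intro h
    obtain ⟨k, hk⟩ := exists_pow_mul_mem hQ hl.homog hF h
    obtain ⟨m₀, hm₀⟩ := hl.surj_pow
    refine mem_saturate.2 ⟨m₀ + k, fun x hx => ?_⟩
    obtain ⟨g, -, hg⟩ := hm₀ m₀ le_rfl k x hx
    have := Q.add_mem (Q.mul_mem_right F (hIQ hg)) (Q.mul_mem_left g hk)
    convert this using 1
    ring

theorem eventually_sup_eq_top (hl : IsTransversal I l) :
    ∀ᶠ m in atTop, homogeneousSubmodule (Fin (n+1)) K m ⊔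
      (I ⊔ Ideal.span {l - 1}).restrictScalars K = ⊤ := by
  obtain ⟨m₀, hm₀⟩ := hl.surj_pow
  filter_upwards [eventually_ge_atTop m₀] with m hm
  have hpow : ∀ k, ∀ g, g - l ^ k * g ∈ I ⊔ Ideal.span {l - 1} := fun k g => by
    have h1 : (l ^ k - 1) * g ∈ Ideal.span {l - 1} :=
      Ideal.mul_mem_right _ _ (Ideal.mem_span_singleton.2 (sub_one_dvd_pow_sub_one l k))
    have := (Ideal.span {l - 1}).neg_mem h1
    refine Ideal.mem_sup_right ?_
    convert this using 1
    ring
  rw [eq_top_iff]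
  intro p _
  rw [← sum_homogeneousComponent p]
  refine Submodule.sum_mem _ fun j _ => ?_
  have hj := homogeneousComponent_isHomogeneous j p
  rcases le_total j m with hjm | hjm
  · refine Submodule.mem_sup.2 ⟨l ^ (m - j) * homogeneousComponent j p, ?_,
      _, hpow (m - j) (homogeneousComponent j p), by ring⟩
    have := (hl.homog.pow (m - j)).mul hj
    rwa [one_mul, Nat.sub_add_cancel hjm] at this
  · obtain ⟨g, hg, hgI⟩ := hm₀ m hm (j - m) (homogeneousComponent j p)
      (by rwa [Nat.add_sub_cancel' hjm])
    refine Submodule.mem_sup.2 ⟨g, hg, homogeneousComponent j p - g, ?_, by ring⟩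
    have := (I ⊔ Ideal.span {l - 1}).sub_mem (Ideal.mem_sup_left hgI) (hpow (j - m) g)
    change _ ∈ I ⊔ Ideal.span {l - 1}
    convert this using 1
    ring

theorem finiteDimensional (hl : IsTransversal I l) :
    FiniteDimensional K (MvPolynomial (Fin (n+1)) K ⧸ (I ⊔ Ideal.span {l - 1})) := by
  obtain ⟨m, hm⟩ := hl.eventually_sup_eq_top.exists
  have := finiteDimensional_homogeneousSubmodule (K := K) (n := n) m
  refine FiniteDimensional.of_surjective
    (f := (Ideal.Quotient.mkₐ K (I ⊔ Ideal.span {l - 1})).toLinearMap.domRestrict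
      (homogeneousSubmodule (Fin (n+1)) K m)) fun x => ?_
  obtain ⟨x, rfl⟩ := Ideal.Quotient.mk_surjective x
  obtain ⟨y, hy, z, hz, rfl⟩ := Submodule.mem_sup.1 (hm ▸ Submodule.mem_top : x ∈ _)
  refine ⟨⟨y, hy⟩, Ideal.Quotient.eq.2 ?_⟩
  change y - (y + z) ∈ _
  rw [sub_add_cancel_left]
  exact Submodule.neg_mem _ hz

theorem finiteDimensional_of_le (hl : IsTransversal I l) {Q : Ideal (MvPolynomial (Fin (n+1)) K)}
    (hIQ : I ≤ Q) :
    FiniteDimensional K (MvPolynomial (Fin (n+1)) K ⧸ (Q ⊔ Ideal.span {l - 1})) :=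
  have := hl.finiteDimensional
  finiteDimensional_quotient_of_le K (sup_le_sup_right hIQ _)

theorem hilbF_saturate_eq_iff (hl : IsTransversal I l) {Q : Ideal (MvPolynomial (Fin (n+1)) K)}
    (hQ : Q.IsHomogeneous (homogeneousSubmodule (Fin (n+1)) K)) (hIQ : I ≤ Q) (m : ℕ) :
    hilbF (saturate Q) m =
        Module.finrank K (MvPolynomial (Fin (n+1)) K ⧸ (Q ⊔ Ideal.span {l - 1})) ↔
      homogeneousSubmodule (Fin (n+1)) K m ⊔ (Q ⊔ Ideal.span {l - 1}).restrictScalars K = ⊤ := by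
  have := hl.finiteDimensional_of_le hIQ
  let q := (Ideal.Quotient.mkₐ K (Q ⊔ Ideal.span {l - 1})).toLinearMap
  have hq : LinearMap.ker q = (Q ⊔ Ideal.span {l - 1}).restrictScalars K := by
    ext x
    exact Ideal.Quotient.eq_zero_iff_mem
  have hsurj : Function.Surjective q := Ideal.Quotient.mk_surjective
  rw [hilbF, finrank_map_congr _ _ q fun x hx =>
    Ideal.Quotient.eq_zero_iff_mem.trans ((hl.mem_saturate_iff hQ hIQ hx).trans
      Ideal.Quotient.eq_zero_iff_mem.symm), ← hq, ← Submodule.comap_map_eq]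
  constructor
  · intro h
    rw [Submodule.eq_top_of_finrank_eq h, Submodule.comap_top]
  · intro h
    rw [← Submodule.map_comap_eq_of_surjective hsurj (Submodule.map q _), h, Submodule.map_top,
      LinearMap.range_eq_top.2 hsurj, finrank_top]

theorem eventually_hilbF_saturate (hl : IsTransversal I l)
    {Q : Ideal (MvPolynomial (Fin (n+1)) K)}
    (hQ : Q.IsHomogeneous (homogeneousSubmodule (Fin (n+1)) K)) (hIQ : I ≤ Q) :
    ∀ᶠ m in atTop, hilbF (saturate Q) m =
      Module.finrank K (MvPolynomial (Fin (n+1)) K ⧸ (Q ⊔ Ideal.span {l - 1})) := by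
  filter_upwards [hl.eventually_sup_eq_top] with m hm
  rw [hl.hilbF_saturate_eq_iff hQ hIQ, eq_top_iff, ← hm]
  exact sup_le_sup_left (fun x hx => sup_le_sup_right hIQ (Ideal.span {l - 1}) hx) _

theorem schemeDeg_saturate (hl : IsTransversal I l) {Q : Ideal (MvPolynomial (Fin (n+1)) K)}
    (hQ : Q.IsHomogeneous (homogeneousSubmodule (Fin (n+1)) K)) (hIQ : I ≤ Q) :
    schemeDeg (saturate Q) =
      Module.finrank K (MvPolynomial (Fin (n+1)) K ⧸ (Q ⊔ Ideal.span {l - 1})) := by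
  have h := hl.eventually_hilbF_saturate hQ hIQ
  have hex : ∃ d : ℕ, ∀ᶠ m : ℕ in atTop, hilbF (saturate Q) m = d := ⟨_, h⟩
  rw [schemeDeg, dif_pos hex]
  obtain ⟨m, hm, hm'⟩ := (hex.choose_spec.and h).exists
  exact hm.symm.trans hm'

theorem hilbF_saturate_eq_schemeDeg_iff (hl : IsTransversal I l)
    {Q : Ideal (MvPolynomial (Fin (n+1)) K)}
    (hQ : Q.IsHomogeneous (homogeneousSubmodule (Fin (n+1)) K)) (hIQ : I ≤ Q) (m : ℕ) :
    hilbF (saturate Q) m = schemeDeg (saturate Q) ↔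
      homogeneousSubmodule (Fin (n+1)) K m ⊔ (Q ⊔ Ideal.span {l - 1}).restrictScalars K = ⊤ := by
  rw [hl.schemeDeg_saturate hQ hIQ, hl.hilbF_saturate_eq_iff hQ hIQ]

end IsTransversal

end Homogeneous

section ResidualScheme

variable {K : Type} [Field K] {n : ℕ} {I : Ideal (MvPolynomial (Fin (n+1)) K)}
  {f l : MvPolynomial (Fin (n+1)) K}

theorem residualIdeal_eq_colonBy (I : Ideal (MvPolynomial (Fin (n+1)) K))
    (f : MvPolynomial (Fin (n+1)) K) : residualIdeal I f = colonBy I f := by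
  ext x
  rw [residualIdeal, Ideal.mem_colon_span_singleton, mem_colonBy, mul_comm]

theorem colonBy_isHomogeneous (hI : I.IsHomogeneous (homogeneousSubmodule (Fin (n+1)) K))
    (hf : f.IsHomogeneous 1) :
    (colonBy I f).IsHomogeneous (homogeneousSubmodule (Fin (n+1)) K) := by
  intro i x hx
  have h : f * homogeneousComponent i x ∈ I := by
    rw [← homogeneousComponent_succ_linear_mul hf]
    exact homogeneousComponent_mem_of_mem hI hx (i + 1)
  rw [← decomposition.decompose'_apply] at h
  exact h

theorem saturate_colonBy (hI : saturate I = I) (f : MvPolynomial (Fin (n+1)) K) :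
    saturate (colonBy I f) = colonBy I f := by
  refine le_antisymm (fun x hx => ?_) fun x hx =>
    mem_saturate.2 ⟨0, fun h _ => Ideal.mul_mem_left _ h hx⟩
  obtain ⟨k, hk⟩ := mem_saturate.1 hx
  rw [mem_colonBy, ← hI]
  refine mem_saturate.2 ⟨k, fun h hh => ?_⟩
  have := mem_colonBy.1 (hk h hh)
  rwa [mul_left_comm] at this

theorem sup_span_isHomogeneous (hI : I.IsHomogeneous (homogeneousSubmodule (Fin (n+1)) K))
    {S : Set (MvPolynomial (Fin (n+1)) K)} (hS : ∀ x ∈ S, x.IsHomogeneous 1) :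
    (I ⊔ Ideal.span S).IsHomogeneous (homogeneousSubmodule (Fin (n+1)) K) :=
  hI.sup (Ideal.homogeneous_span _ _ fun x hx => ⟨1, hS x hx⟩)

namespace IsTransversal

theorem colonBy_sup (hl : IsTransversal I l) (hI : IsFiniteSubscheme I) (hf : f.IsHomogeneous 1) :
    colonBy I f ⊔ Ideal.span {l - 1} = colonBy (I ⊔ Ideal.span {l - 1}) f := by
  apply le_antisymm
  · exact sup_le (fun x hx => Ideal.mem_sup_left hx) (le_sup_right.trans (le_colonBy _ f))
  · intro g hg
    obtain ⟨m, hm⟩ := hl.eventually_sup_eq_top.exists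
    obtain ⟨y, hy, z, hz, rfl⟩ := Submodule.mem_sup.1 (hm ▸ Submodule.mem_top : g ∈ _)
    have hz' : z ∈ I ⊔ Ideal.span {l - 1} := hz
    have hfy : f * y ∈ I ⊔ Ideal.span {l - 1} := by
      have := Ideal.sub_mem _ (mem_colonBy.1 hg) (Ideal.mul_mem_left _ f hz')
      rwa [mul_add, add_sub_cancel_right] at this
    rw [← hl.mem_saturate_iff hI.homog le_rfl (hf.mul hy), hI.saturated] at hfy
    exact Ideal.add_mem _ (Ideal.mem_sup_left hfy) (sup_le_sup_right (le_colonBy I f) _ hz')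

theorem sup_eq_top_of_le (hl : IsTransversal I l) {Q : Ideal (MvPolynomial (Fin (n+1)) K)}
    {k m : ℕ} (hkm : k ≤ m)
    (h : homogeneousSubmodule (Fin (n+1)) K k ⊔
      (Q ⊔ Ideal.span {l - 1}).restrictScalars K = ⊤) :
    homogeneousSubmodule (Fin (n+1)) K m ⊔ (Q ⊔ Ideal.span {l - 1}).restrictScalars K = ⊤ := by
  rw [eq_top_iff]
  intro x _
  obtain ⟨y, hy, z, hz, rfl⟩ := Submodule.mem_sup.1 (h ▸ Submodule.mem_top : x ∈ _)
  have h1 : (l ^ (m - k) - 1) * y ∈ Ideal.span {l - 1} :=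
    Ideal.mul_mem_right _ _ (Ideal.mem_span_singleton.2 (sub_one_dvd_pow_sub_one l _))
  refine Submodule.mem_sup.2 ⟨l ^ (m - k) * y, ?_, z - (l ^ (m - k) - 1) * y,
    Ideal.sub_mem _ hz (Ideal.mem_sup_right h1), by ring⟩
  have := (hl.homog.pow (m - k)).mul hy
  rwa [one_mul, Nat.sub_add_cancel hkm] at this

/-- A finite scheme of degree at most `k * t + 1` without `(s+2)`-secant `s`-planes for `s < t` is
`m`-normal for all `m ≥ k`. -/
theorem sup_eq_top_of_not_hasSecantPlane [IsAlgClosed K] (hl : IsTransversal I l)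
    {Q : Ideal (MvPolynomial (Fin (n+1)) K)}
    (hQ : Q.IsHomogeneous (homogeneousSubmodule (Fin (n+1)) K)) (hIQ : I ≤ Q) {t k : ℕ}
    (ht : ∀ s < t, ¬ HasSecantPlane Q s)
    (hk : Module.finrank K (MvPolynomial (Fin (n+1)) K ⧸ (Q ⊔ Ideal.span {l - 1})) ≤ k * t + 1)
    {m : ℕ} (hm : k ≤ m) :
    homogeneousSubmodule (Fin (n+1)) K m ⊔ (Q ⊔ Ideal.span {l - 1}).restrictScalars K = ⊤ := by
  refine hl.sup_eq_top_of_le hm ?_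
  rw [← homogeneousSubmodule_one_pow]
  have := finiteDimensional_homogeneousSubmodule (K := K) (n := n) 1
  have := hl.finiteDimensional_of_le hIQ
  refine pow_sup_eq_top_of_finrank_le _ t k _ (fun W hW c hc hWc => ?_) hk
  rcases c with _ | s
  · have hWV : W = homogeneousSubmodule (Fin (n+1)) K 1 :=
      Submodule.eq_of_le_of_finrank_eq hW hWc
    have htop : Q ⊔ Ideal.span {l - 1} ⊔ Ideal.span (W : Set (MvPolynomial (Fin (n+1)) K)) = ⊤ := by
      rw [Ideal.eq_top_iff_one]
      have h1 : l ∈ Ideal.span (W : Set (MvPolynomial (Fin (n+1)) K)) :=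
        Ideal.subset_span (by rw [hWV]; exact hl.homog)
      have h2 : l - 1 ∈ Q ⊔ Ideal.span {l - 1} :=
        Ideal.mem_sup_right (Ideal.mem_span_singleton_self _)
      have := Ideal.sub_mem _ (Ideal.mem_sup_right h1) (Ideal.mem_sup_left h2)
      rwa [sub_sub_cancel] at this
    rw [htop]
    have := Ideal.Quotient.subsingleton_iff.2 (rfl : (⊤ : Ideal (MvPolynomial (Fin (n+1)) K)) = ⊤)
    rw [Module.finrank_zero_of_subsingleton]
  · by_contra! hlt
    rw [finrank_homogeneousSubmodule_one] at hWc
    refine ht s (by omega) ⟨_, ⟨W, hW, by omega, rfl⟩, ?_⟩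
    rw [interIdeal, hl.schemeDeg_saturate (sup_span_isHomogeneous hQ fun x hx => hW hx)
      (hIQ.trans le_sup_left), sup_right_comm]
    omega

end IsTransversal

theorem HasSecantPlane.of_le [Infinite K] (hI : IsFiniteSubscheme I)
    {Q : Ideal (MvPolynomial (Fin (n+1)) K)}
    (hQ : Q.IsHomogeneous (homogeneousSubmodule (Fin (n+1)) K)) (hIQ : I ≤ Q) {s : ℕ}
    (h : HasSecantPlane Q s) : HasSecantPlane I s := by
  obtain ⟨l, hl⟩ := hI.exists_isTransversal
  obtain ⟨J, hJ, hs⟩ := h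
  refine ⟨J, hJ, hs.trans ?_⟩
  obtain ⟨W, hW, -, rfl⟩ := hJ
  rw [interIdeal, interIdeal,
    hl.schemeDeg_saturate (sup_span_isHomogeneous hQ fun x hx => hW hx) (hIQ.trans le_sup_left),
    hl.schemeDeg_saturate (sup_span_isHomogeneous hI.homog fun x hx => hW hx) le_sup_left]
  have := hl.finiteDimensional_of_le (le_sup_left : I ≤ I ⊔ Ideal.span (W : Set _))
  exact finrank_quotient_le_of_le K (sup_le_sup_right (sup_le_sup_right hIQ _) _)

/-- If the residual scheme of a hyperplane section is `m`-normal for all `m ≥ k`, and the section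
has regularity at most `k + 2`, then the scheme has regularity at most `k + 2`. -/
theorem schemeReg_le_of_residual [Infinite K] (hI : IsFiniteSubscheme I) (hf : f.IsHomogeneous 1)
    (hl : IsTransversal I l) {k : ℕ}
    (hH : schemeReg (interIdeal I (Ideal.span {f})) ≤ k + 2)
    (hres : ∀ m ≥ k, homogeneousSubmodule (Fin (n+1)) K m ⊔
      (colonBy I f ⊔ Ideal.span {l - 1}).restrictScalars K = ⊤) :
    schemeReg I ≤ k + 2 := by
  have hhom : (I ⊔ Ideal.span {f}).IsHomogeneous (homogeneousSubmodule (Fin (n+1)) K) :=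
    sup_span_isHomogeneous hI.homog (by simpa using hf)
  have hne : {p : ℕ | 1 ≤ p ∧ ∀ m : ℕ, p - 1 ≤ m →
      hilbF (interIdeal I (Ideal.span {f})) m =
        schemeDeg (interIdeal I (Ideal.span {f}))}.Nonempty := by
    obtain ⟨N, hN⟩ := eventually_atTop.1 (hl.eventually_hilbF_saturate hhom le_sup_left)
    refine ⟨N + 1, by omega, fun m hm => ?_⟩
    rw [interIdeal, hl.schemeDeg_saturate hhom le_sup_left]
    exact hN m (by omega)
  have hspec := (Nat.sInf_mem hne).2
  refine Nat.sInf_le ⟨by omega, fun m hm => ?_⟩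
  obtain ⟨m, rfl⟩ : ∃ m', m = m' + 1 := ⟨m - 1, by omega⟩
  have h2 := hspec (m + 1) (by rw [schemeReg] at hH; omega)
  rw [interIdeal, hl.hilbF_saturate_eq_schemeDeg_iff hhom le_sup_left] at h2
  have h1 := hres m (by omega)
  rw [← hI.saturated, hl.hilbF_saturate_eq_schemeDeg_iff hI.homog le_rfl,
    ← homogeneousSubmodule_one_pow]
  rw [hl.colonBy_sup hI hf, ← homogeneousSubmodule_one_pow] at h1
  rw [sup_right_comm, ← homogeneousSubmodule_one_pow] at h2
  exact pow_succ_sup_eq_top hf h1 h2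

end ResidualScheme

/-- Lemma 3.3.(4). -/
theorem stmt9 (K : Type) [Field K] [IsAlgClosed K] [CharZero K] (n d : ℕ)
    (I : Ideal (MvPolynomial (Fin (n+1)) K))
    (hfin : IsFiniteSubscheme I) (hnd : NondegenerateScheme I)
    (hdeg : schemeDeg I = d)
    (hlow : ⌈((d : ℚ) - n - 1) / ((tInv I : ℚ) + 1)⌉ + 3 ≤ (schemeReg I : ℤ))
    (hhigh : (schemeReg I : ℤ) ≤ ⌈((d : ℚ) - n - 1) / (tInv I : ℚ)⌉ + 2)
    (f : MvPolynomial (Fin (n+1)) K) (hf0 : f ≠ 0) (hfh : f.IsHomogeneous 1)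
    (hsec : n + 1 ≤ schemeDeg (interIdeal I (Ideal.span {f})))
    (hregH : schemeReg (interIdeal I (Ideal.span {f})) < schemeReg I) :
    tInv (residualIdeal I f) = tInv I := by
  rw [residualIdeal_eq_colonBy]
  obtain ⟨l, hl⟩ := hfin.exists_isTransversal
  have hhom := colonBy_isHomogeneous hfin.homog hfh
  have hIle := le_colonBy I f
  have hmono : ∀ s, HasSecantPlane (colonBy I f) s → HasSecantPlane I s :=
    fun s => HasSecantPlane.of_le hfin hhom hIle
  have hex : ∃ s ≤ tInv I, HasSecantPlane (colonBy I f) s := by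
    by_contra! hno
    have hcount : Module.finrank K (MvPolynomial (Fin (n+1)) K ⧸
        (colonBy I f ⊔ Ideal.span {l - 1})) + (n + 1) ≤ d := by
      have := hl.finiteDimensional
      have hadd := finrank_colonBy_add K (I ⊔ Ideal.span {l - 1}) f
      rw [← hl.colonBy_sup hfin hfh, sup_right_comm,
        ← hl.schemeDeg_saturate (sup_span_isHomogeneous hfin.homog (by simpa using hfh))
          le_sup_left,
        ← hl.schemeDeg_saturate hfin.homog le_rfl, hfin.saturated, hdeg] at hadd
      rw [interIdeal] at hsec
      omega
    obtain ⟨k, hk⟩ : ∃ k : ℕ, schemeReg I = k + 3 := by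
      refine ⟨schemeReg I - 3, ?_⟩
      have h0 : 0 ≤ ⌈((d : ℚ) - n - 1) / ((tInv I : ℚ) + 1)⌉ := by
        have hd : (n : ℚ) + 1 ≤ d := by exact_mod_cast (by omega : n + 1 ≤ d)
        exact Int.ceil_nonneg (div_nonneg (by linarith) (by positivity))
      omega
    have hkd : d ≤ k * (tInv I + 1) + n + 1 := by
      have h1 : ⌈((d : ℚ) - n - 1) / ((tInv I : ℚ) + 1)⌉ ≤ (k : ℤ) := by omega
      rw [Int.ceil_le, div_le_iff₀ (by positivity)] at h1
      push_cast at h1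
      have h2 : (d : ℚ) ≤ k * (tInv I + 1) + n + 1 := by linarith
      exact_mod_cast h2
    have hreg := schemeReg_le_of_residual hfin hfh hl (k := k) (by omega) fun m hm =>
      hl.sup_eq_top_of_not_hasSecantPlane hhom hIle (t := tInv I + 1)
        (fun s hs => hno s (by omega)) (by omega) hm
    omega
  obtain ⟨s, hs, hsI⟩ := hex
  have hne : {t : ℕ | HasSecantPlane (colonBy I f) t}.Nonempty := ⟨s, hsI⟩
  exact le_antisymm ((Nat.sInf_le hsI).trans hs) (Nat.sInf_le (hmono _ (Nat.sInf_mem hne)))
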